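/- Let V be a ℤ-graded F-vector space with V_(k) = 0 for k sufficiently small, equipped with linear maps Y(x)v = Σ_{k∈ℤ}Δ_k(v)x^{-k-1} and c : V → F satisfying all the axioms of a graded vertex coalgebra except possibly the Jacobi identity. If weak cocommutativity holds (for every v' ∈ (V^{⊗3})' there exists k ∈ ℤ_+ such that (x_1−x_2)^k ⟨v', (Id_V⊗Y(x_2))Y(x_1)v − (T⊗Id_V)(Id_V⊗Y(x_1))Y(x_2)v⟩ = 0 for all v ∈ V) and the D*-bracket formula holds ((d/dx)Y(x) = Y(x)∘D* − (Id_V ⊗ D*)∘Y(x), where D* = (Id_V ⊗ c)Δ_{-2}), then the Jacobi identity holds, so (V, Y, c) is a graded vertex coalgebra. -/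

import Mathlib

/- Common background for the formalization of "Vertex coalgebras, comodules,
cocommutativity and coassociativity" (K. Hubbard).

A vertex coalgebra `(V, Y, c)` is encoded by the family of coefficient maps
`Δ k : V →ₗ V ⊗ V` of the coproduct `Y(x)v = ∑ₖ Δ k v · x^(-k-1)` together with
the covacuum `c : V →ₗ F`.  All identities of formal series are encoded
coefficient-wise; in particular the Jacobi identity is encoded by its
(dual Borcherds) coefficient form. -/

noncomputable section

open scoped TensorProduct

variable (F : Type) [Field F] [CharZero F]

/-- The generalized binomial coefficient `(a choose i)` as an element of `F`. -/
def gchoose (a : ℤ) (i : ℕ) : F :=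
  (∏ j ∈ Finset.range i, ((a : F) - (j : F))) / (Nat.factorial i : F)

variable {V M : Type} [AddCommGroup V] [Module F V] [AddCommGroup M] [Module F M]

/-- `c ⊗ Id` composed with the canonical identification `F ⊗ M ≃ M`. -/
def cLeft (c : V →ₗ[F] F) : V ⊗[F] M →ₗ[F] M :=
  (TensorProduct.lid F M).toLinearMap ∘ₗ TensorProduct.map c LinearMap.id

/-- `Id ⊗ c` composed with the canonical identification `V ⊗ F ≃ V`. -/
def cRight (c : M →ₗ[F] F) : V ⊗[F] M →ₗ[F] V :=
  (TensorProduct.rid F V).toLinearMap ∘ₗ TensorProduct.map LinearMap.id c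

/-- The transposition `T ⊗ Id` of the first two tensor factors of `V ⊗ (V ⊗ M)`. -/
def Tfirst : V ⊗[F] (V ⊗[F] M) →ₗ[F] V ⊗[F] (V ⊗[F] M) :=
  (TensorProduct.assoc F V V M).toLinearMap ∘ₗ
    TensorProduct.map (TensorProduct.comm F V V).toLinearMap LinearMap.id ∘ₗ
    (TensorProduct.assoc F V V M).symm.toLinearMap

/-- The coefficient of `x₁^(-m-1) x₂^(-n-1)` in `(Id ⊗ Y(x₂)) Y(x₁)`. -/
def comp12 (ΔM : ℤ → M →ₗ[F] V ⊗[F] M) (m n : ℤ) : M →ₗ[F] V ⊗[F] (V ⊗[F] M) :=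
  TensorProduct.map LinearMap.id (ΔM n) ∘ₗ ΔM m

/-- The coefficient of `x₀^(-m-1) x₂^(-n-1)` in `(Y(x₀) ⊗ Id) Y(x₂)`. -/
def compR (ΔV : ℤ → V →ₗ[F] V ⊗[F] V) (ΔM : ℤ → M →ₗ[F] V ⊗[F] M) (m n : ℤ) :
    M →ₗ[F] V ⊗[F] (V ⊗[F] M) :=
  (TensorProduct.assoc F V V M).toLinearMap ∘ₗ TensorProduct.map (ΔV m) LinearMap.id ∘ₗ ΔM n

/-- The coefficient form of the (comodule) Jacobi identity of a vertex coalgebra,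
obtained by extracting the coefficient of `x₀^(-a-1) x₁^(-b-1) x₂^(-c-1)`. -/
def JacobiId (ΔV : ℤ → V →ₗ[F] V ⊗[F] V) (ΔM : ℤ → M →ₗ[F] V ⊗[F] M) : Prop :=
  ∀ (a b c : ℤ) (w : M),
    (∑ᶠ i : ℕ, ((-1 : F) ^ i * gchoose F a i) •
        (comp12 F ΔM (a + b - i) (c + i) w -
          (-1 : F) ^ a • Tfirst F (comp12 F ΔM (a + c - i) (b + i) w))) =
      ∑ᶠ i : ℕ, gchoose F b i • compR F ΔV ΔM (a + i) (b + c - i) w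

/-- The axioms of a vertex coalgebra except the Jacobi identity: left counit,
cocreation and truncation, in coefficient form. -/
def IsVertexCoalgSansJacobi (Δ : ℤ → V →ₗ[F] V ⊗[F] V) (c : V →ₗ[F] F) : Prop :=
  (∀ v : V, cLeft F c (Δ (-1) v) = v) ∧
  (∀ k : ℤ, k ≠ -1 → ∀ v : V, cLeft F c (Δ k v) = 0) ∧
  (∀ v : V, cRight F c (Δ (-1) v) = v) ∧
  (∀ k : ℤ, 0 ≤ k → ∀ v : V, cRight F c (Δ k v) = 0) ∧
  (∀ v : V, ∃ N : ℤ, ∀ k : ℤ, k < N → Δ k v = 0)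

/-- The axioms of a vertex coalgebra. -/
def IsVertexCoalg (Δ : ℤ → V →ₗ[F] V ⊗[F] V) (c : V →ₗ[F] F) : Prop :=
  IsVertexCoalgSansJacobi F Δ c ∧ JacobiId F Δ Δ

/-- The weight-`m` component of `V ⊗ V` for a graded space `V`. -/
def grT2 (gr : ℤ → Submodule F V) (m : ℤ) : Submodule F (V ⊗[F] V) :=
  ⨆ p : ℤ, LinearMap.range (TensorProduct.map (gr p).subtype (gr (m - p)).subtype)

/-- The weight-`m` component of `V ⊗ (V ⊗ V)` for a graded space `V`. -/
def grT3 (gr : ℤ → Submodule F V) (m : ℤ) : Submodule F (V ⊗[F] (V ⊗[F] V)) :=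
  ⨆ p : ℤ × ℤ, LinearMap.range (TensorProduct.map (gr p.1).subtype
    (TensorProduct.map (gr p.2).subtype (gr (m - p.1 - p.2)).subtype))

/-- The grading axioms of a graded vertex coalgebra: `V = ⊕ₖ V₍ₖ₎` internally,
`V₍ₖ₎ = 0` for `k` sufficiently small, and `Δ k` raises weight by `k + 1`. -/
def IsGradedVC (Δ : ℤ → V →ₗ[F] V ⊗[F] V) (gr : ℤ → Submodule F V) : Prop :=
  DirectSum.IsInternal gr ∧ (∃ N : ℤ, ∀ k : ℤ, k < N → gr k = ⊥) ∧
  (∀ r k : ℤ, ∀ v ∈ gr r, Δ k v ∈ grT2 F gr (r + k + 1))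

/-- `f` belongs to the graded dual `(V^{⊗3})'`: it vanishes on all but finitely
many homogeneous components of `V ⊗ V ⊗ V`. -/
def GradedDual3 (gr : ℤ → Submodule F V) (f : V ⊗[F] (V ⊗[F] V) →ₗ[F] F) : Prop :=
  ∃ s : Finset ℤ, ∀ m : ℤ, m ∉ s → ∀ u ∈ grT3 F gr m, f u = 0

/-- The weight-`q` component of `V ⊗ M` for `V` a `ℤ`-graded space and
`M` a `ℚ`-graded space. -/
def grVM (gr : ℤ → Submodule F V) (grM : ℚ → Submodule F M) (q : ℚ) :
    Submodule F (V ⊗[F] M) :=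
  ⨆ p : ℤ, LinearMap.range (TensorProduct.map (gr p).subtype (grM (q - p)).subtype)

/-- The weight-`q` component of `V ⊗ (V ⊗ M)`. -/
def grVVM (gr : ℤ → Submodule F V) (grM : ℚ → Submodule F M) (q : ℚ) :
    Submodule F (V ⊗[F] (V ⊗[F] M)) :=
  ⨆ p : ℤ × ℤ, LinearMap.range (TensorProduct.map (gr p.1).subtype
    (TensorProduct.map (gr p.2).subtype (grM (q - p.1 - p.2)).subtype))

/-- `f` belongs to the graded dual `(V ⊗ V ⊗ M)'`. -/
def GradedDualVVM (gr : ℤ → Submodule F V) (grM : ℚ → Submodule F M)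
    (f : V ⊗[F] (V ⊗[F] M) →ₗ[F] F) : Prop :=
  ∃ s : Finset ℚ, ∀ q : ℚ, q ∉ s → ∀ u ∈ grVVM F gr grM q, f u = 0

/-- The axioms of a comodule over a graded vertex coalgebra, except the Jacobi
identity: left counit, truncation, internal `ℚ`-grading bounded below, and the
grading condition on the comodule coproduct. -/
def IsComoduleSansJacobi (c : V →ₗ[F] F) (ΔM : ℤ → M →ₗ[F] V ⊗[F] M)
    (gr : ℤ → Submodule F V) (grM : ℚ → Submodule F M) : Prop :=
  (∀ w : M, cLeft F c (ΔM (-1) w) = w) ∧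
  (∀ k : ℤ, k ≠ -1 → ∀ w : M, cLeft F c (ΔM k w) = 0) ∧
  (∀ w : M, ∃ N : ℤ, ∀ k : ℤ, k < N → ΔM k w = 0) ∧
  DirectSum.IsInternal grM ∧ (∃ N : ℚ, ∀ q : ℚ, q < N → grM q = ⊥) ∧
  (∀ (j : ℚ) (k : ℤ), ∀ w ∈ grM j, ΔM k w ∈ grVM F gr grM (j + k + 1))

/-- Weak cocommutativity with exponent `k`, paired against `f`, coefficient-wise:
the coefficient of `x₁^(-b-1) x₂^(-c-1)` in
`(x₁-x₂)^k ⟨f, (Id ⊗ Y(x₂))Y(x₁)w - (T ⊗ Id)(Id ⊗ Y(x₁))Y(x₂)w⟩` vanishes. -/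
def WeakCocom (ΔM : ℤ → M →ₗ[F] V ⊗[F] M) (f : V ⊗[F] (V ⊗[F] M) →ₗ[F] F)
    (k : ℕ) : Prop :=
  ∀ (w : M) (b c : ℤ),
    ∑ j ∈ Finset.range (k + 1), ((-1 : F) ^ j * (k.choose j : F)) *
      (f (comp12 F ΔM (b + k - j) (c + j) w) -
        f (Tfirst F (comp12 F ΔM (c + j) (b + k - j) w))) = 0

/-- Weak coassociativity with exponent `k`, paired against `f`, coefficient-wise:
the coefficient of `x₀^(-a-1) x₂^(-c-1)` in
`(x₀+x₂)^k ⟨f, (Y(x₀) ⊗ Id)Y(x₂)w - (Id ⊗ Y(x₂))Y(x₀+x₂)w⟩` vanishes,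
`Y(x₀+x₂)` being expanded in nonnegative integral powers of `x₂`. -/
def WeakCoassoc (ΔV : ℤ → V →ₗ[F] V ⊗[F] V) (ΔM : ℤ → M →ₗ[F] V ⊗[F] M)
    (f : V ⊗[F] (V ⊗[F] M) →ₗ[F] F) (k : ℕ) : Prop :=
  ∀ (w : M) (a c : ℤ),
    ∑ j ∈ Finset.range (k + 1), (k.choose j : F) *
      (f (compR F ΔV ΔM (a + k - j) (c + j) w) -
        ∑ᶠ i : ℕ, ((-1 : F) ^ i * gchoose F (a + k - j) i) *
          f (comp12 F ΔM (a + k - j - i) (c + j + i) w)) = 0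

/-- The coefficient function of `x^r y^s (x + ε y)^t · A`, where `A : ℤ → ℤ → F`
is the coefficient function of a formal series (`A m n` is the coefficient of
`x^m y^n`). -/
def mulPoly (r s t : ℕ) (ε : F) (A : ℤ → ℤ → F) (m n : ℤ) : F :=
  ∑ j ∈ Finset.range (t + 1), (t.choose j : F) * ε ^ j *
    A (m - (r : ℤ) - ((t - j : ℕ) : ℤ)) (n - (s : ℤ) - (j : ℤ))

/-- `g` is the coefficient function of a polynomial in two variables. -/
def IsPolyCoeff (g : ℤ → ℤ → F) : Prop :=
  {p : ℤ × ℤ | g p.1 p.2 ≠ 0}.Finite ∧ ∀ m n : ℤ, m < 0 ∨ n < 0 → g m n = 0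

/-- The coefficient function of the polynomial `h(x₁ - x₂, x₂)` in the
variables `x₁, x₂`, given the coefficient function of `h = h(x₀, x₂)`. -/
def substC (h : ℤ → ℤ → F) (m n : ℤ) : F :=
  ∑ᶠ j : ℕ, ((-1 : F) ^ j * gchoose F (m + j) j) * h (m + j) (n - j)

/-- The coefficient form of the Jacobi identity of a vertex algebra (the
Borcherds identity). -/
def VAJacobi (mul : ℤ → V →ₗ[F] V →ₗ[F] V) : Prop :=
  ∀ (a b c : ℤ) (u v w : V),
    (∑ᶠ i : ℕ, ((-1 : F) ^ i * gchoose F a i) •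
        (mul (a + b - i) u (mul (c + i) v w) -
          (-1 : F) ^ a • mul (a + c - i) v (mul (b + i) u w))) =
      ∑ᶠ i : ℕ, gchoose F b i • mul (b + c - i) (mul (a + i) u v) w

/-- The axioms of a vertex algebra: truncation, vacuum, creation and the Jacobi
identity, in coefficient form (`mul n u v` is `u_n v`). -/
def IsVA (mul : ℤ → V →ₗ[F] V →ₗ[F] V) (one : V) : Prop :=
  (∀ u v : V, ∃ N : ℤ, ∀ n : ℤ, N < n → mul n u v = 0) ∧
  (∀ v : V, mul (-1) one v = v) ∧
  (∀ n : ℤ, n ≠ -1 → ∀ v : V, mul n one v = 0) ∧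
  (∀ v : V, mul (-1) v one = v) ∧
  (∀ n : ℤ, 0 ≤ n → ∀ v : V, mul n v one = 0) ∧
  VAJacobi F mul

/-- The graded dual `V' = ⊕ₖ V₍ₖ₎*`, realized as the submodule of the full dual
consisting of functionals vanishing on all but finitely many components. -/
def gradedDual (gr : ℤ → Submodule F V) : Submodule F (Module.Dual F V) where
  carrier := {φ | ∃ s : Finset ℤ, ∀ k ∉ s, ∀ u ∈ gr k, φ u = 0}
  zero_mem' := ⟨∅, by intro k _ u _; simp⟩
  add_mem' := by
    rintro a b ⟨s, hs⟩ ⟨t, ht⟩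
    refine ⟨s ∪ t, ?_⟩
    intro k hk u hu
    simp only [Finset.mem_union, not_or] at hk
    simp [LinearMap.add_apply, hs k hk.1 u hu, ht k hk.2 u hu]
  smul_mem' := by
    rintro r a ⟨s, hs⟩
    refine ⟨s, ?_⟩
    intro k hk u hu
    simp [LinearMap.smul_apply, hs k hk u hu]

/-- The weight-`k` component `V₍ₖ₎* ⊆ V'` of the graded dual: functionals
vanishing on every component of weight other than `k`. -/
def gradedDualPiece (gr : ℤ → Submodule F V) (k : ℤ) :
    Submodule F ↥(gradedDual F gr) where
  carrier := {φ | ∀ j : ℤ, j ≠ k → ∀ u ∈ gr j, (φ : Module.Dual F V) u = 0}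
  zero_mem' := by intro j _ u _; simp
  add_mem' := by
    intro a b ha hb j hj u hu
    simp [ha j hj u hu, hb j hj u hu]
  smul_mem' := by
    intro r a ha j hj u hu
    simp [ha j hj u hu]

/-- The natural pairing of `V' ⊗ V'` with `V ⊗ V`. -/
def pairVV (gr : ℤ → Submodule F V) :
    ↥(gradedDual F gr) ⊗[F] ↥(gradedDual F gr) →ₗ[F] Module.Dual F (V ⊗[F] V) :=
  TensorProduct.dualDistrib F V V ∘ₗ
    TensorProduct.map (gradedDual F gr).subtype (gradedDual F gr).subtype

/-- The covacuum map on the graded dual: evaluation at the vacuum. -/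
def covac (gr : ℤ → Submodule F V) (one : V) : ↥(gradedDual F gr) →ₗ[F] F :=
  LinearMap.applyₗ one ∘ₗ (gradedDual F gr).subtype

/-- A bilinear form `B` on `V` extended componentwise to `V ⊗ V`. -/
def formT2 (B : V →ₗ[F] V →ₗ[F] F) : V ⊗[F] V →ₗ[F] Module.Dual F (V ⊗[F] V) :=
  TensorProduct.dualDistrib F V V ∘ₗ TensorProduct.map B B

set_option linter.unusedSectionVars false

/-! ### Generalized binomial coefficients -/

theorem gchoose_zero (a : ℤ) : gchoose F a 0 = 1 := by simp [gchoose]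

theorem gchoose_succ_mul (a : ℤ) (i : ℕ) :
    gchoose F a (i + 1) * ((i : F) + 1) = gchoose F a i * ((a : F) - i) := by
  have h1 : (i : F) + 1 ≠ 0 := Nat.cast_add_one_ne_zero i
  have h2 : (i.factorial : F) ≠ 0 := Nat.cast_ne_zero.2 i.factorial_ne_zero
  simp only [gchoose, Finset.prod_range_succ, Nat.factorial_succ, Nat.cast_mul, Nat.cast_add,
    Nat.cast_one]
  field_simp

theorem gchoose_pascal (a : ℤ) (i : ℕ) :
    gchoose F (a + 1) (i + 1) = gchoose F a i + gchoose F a (i + 1) := by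
  induction i with
  | zero =>
    have h1 := gchoose_succ_mul F (a + 1) 0
    have h2 := gchoose_succ_mul F a 0
    simp only [gchoose_zero] at *
    push_cast at *
    linear_combination h1 - h2
  | succ i ih =>
    have h : ((i + 1 : ℕ) : F) + 1 ≠ 0 := Nat.cast_add_one_ne_zero (i + 1)
    apply mul_right_cancel₀ h
    have h1 := gchoose_succ_mul F (a + 1) (i + 1)
    have h2 := gchoose_succ_mul F a (i + 1)
    have h3 := gchoose_succ_mul F a i
    push_cast at *
    linear_combination h1 - h2 - h3 + ((a : F) - i) * ih

theorem gchoose_natCast (k i : ℕ) : gchoose F (k : ℤ) i = (k.choose i : F) := by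
  induction k generalizing i with
  | zero =>
    cases i with
    | zero => simp [gchoose_zero]
    | succ i => simp [gchoose, Finset.prod_range_succ']
  | succ k ih =>
    cases i with
    | zero => simp [gchoose_zero]
    | succ i =>
      rw [Nat.cast_succ, gchoose_pascal, ih, ih, Nat.choose_succ_succ, Nat.cast_add]

theorem gchoose_neg_one (i : ℕ) : gchoose F (-1) i = (-1) ^ i := by
  induction i with
  | zero => simp [gchoose_zero]
  | succ i ih =>
    have h : (i : F) + 1 ≠ 0 := Nat.cast_add_one_ne_zero i
    apply mul_right_cancel₀ h
    rw [gchoose_succ_mul, ih, pow_succ]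
    push_cast
    ring

/-! ### Binomial sums -/

section BinomialSums

variable {U : Type} [AddCommGroup U] [Module F U]

/-- The binomial sum `∑ᵢ (a choose i) h i`. -/
def binSum (a : ℤ) (h : ℕ → U) : U := ∑ᶠ i : ℕ, gchoose F a i • h i

theorem binSum_eq_sum (a : ℤ) {h : ℕ → U} {N : ℕ} (hN : ∀ i, N ≤ i → h i = 0) :
    binSum F a h = ∑ i ∈ Finset.range N, gchoose F a i • h i := by
  refine finsum_eq_sum_of_support_subset _ fun i hi => ?_
  by_contra hc
  exact hi (by simp [hN i (by simpa using hc)])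

theorem binSum_natCast (k : ℕ) (h : ℕ → U) :
    binSum F (k : ℤ) h = ∑ i ∈ Finset.range (k + 1), (k.choose i : F) • h i := by
  simp only [binSum, gchoose_natCast]
  refine finsum_eq_sum_of_support_subset _ fun i hi => ?_
  by_contra hc
  exact hi (by simp [Nat.choose_eq_zero_of_lt (show k < i by simpa using hc)])

theorem binSum_zero_left (h : ℕ → U) : binSum F 0 h = h 0 := by
  simpa using binSum_natCast F 0 h

theorem binSum_eq_zero (a : ℤ) {h : ℕ → U} (hh : ∀ i, h i = 0) : binSum F a h = 0 := by
  simp [binSum, hh]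

theorem binSum_succ_left (a : ℤ) {h : ℕ → U} {N : ℕ} (hN : ∀ i, N ≤ i → h i = 0) :
    binSum F (a + 1) h = binSum F a h + binSum F a (fun i => h (i + 1)) := by
  rw [binSum_eq_sum F (N := N + 1) _ fun i hi => hN i (by omega),
    binSum_eq_sum F (N := N + 1) _ fun i hi => hN i (by omega),
    binSum_eq_sum F (N := N) _ fun i hi => hN (i + 1) (by omega),
    Finset.sum_range_succ', Finset.sum_range_succ' (fun i => gchoose F a i • h i)]
  simp only [gchoose_pascal, add_smul, Finset.sum_add_distrib, gchoose_zero]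
  abel

theorem binSum_neg (a : ℤ) (h : ℕ → U) : binSum F a (fun i => -h i) = -binSum F a h := by
  simp only [binSum, smul_neg, finsum_neg_distrib]

theorem binSum_sum {ι : Type} (a : ℤ) (s : Finset ι) {h : ι → ℕ → U}
    (hN : ∀ m ∈ s, ∃ N : ℕ, ∀ i, N ≤ i → h m i = 0) :
    binSum F a (fun i => ∑ m ∈ s, h m i) = ∑ m ∈ s, binSum F a (h m) := by
  simp only [binSum, Finset.smul_sum]
  refine finsum_sum_comm s (fun i m => gchoose F a i • h m i) fun m hm => ?_
  obtain ⟨N, hN⟩ := hN m hm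
  refine (Finset.finite_toSet (Finset.range N)).subset fun i hi => ?_
  by_contra hc
  exact hi (by simp [hN i (by simpa using hc)])

theorem binSum_smul (a : ℤ) (r : F) (h : ℕ → U) :
    binSum F a (fun i => r • h i) = r • binSum F a h := by
  simp only [binSum, smul_finsum, smul_comm r]

/-- The sum `∑ᵢ (-1)ⁱ (a choose i) g (a + b - i) (c + i)`: the coefficient of
`x₁^(-b-1) x₂^(-c-1)` in `(x₁ - x₂)^a ∑ g m n x₁^(-m-1) x₂^(-n-1)`. -/
def iterSum (g : ℤ → ℤ → U) (a b c : ℤ) : U :=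
  binSum F a fun i => (-1 : F) ^ i • g (a + b - i) (c + i)

/-- The sum `∑ᵢ (b choose i) h (a + i) (b + c - i)`. -/
def nestSum (h : ℤ → ℤ → U) (a b c : ℤ) : U :=
  binSum F b fun i => h (a + i) (b + c - i)

theorem iterSum_eq_zero {g : ℤ → ℤ → U} {N : ℤ} (hg : ∀ m n, N ≤ n → g m n = 0)
    (a b c : ℤ) (hc : N ≤ c) : iterSum F g a b c = 0 :=
  binSum_eq_zero F _ fun i => by rw [hg _ _ (by omega), smul_zero]

theorem nestSum_eq_zero {h : ℤ → ℤ → U} {N : ℤ} (hh : ∀ m n, N ≤ m → h m n = 0)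
    (a b c : ℤ) (ha : N ≤ a) : nestSum F h a b c = 0 :=
  binSum_eq_zero F _ fun i => hh _ _ (by omega)

theorem iterSum_succ {g : ℤ → ℤ → U} {N : ℤ} (hg : ∀ m n, N ≤ n → g m n = 0) (a b c : ℤ) :
    iterSum F g (a + 1) b c = iterSum F g a (b + 1) c - iterSum F g a b (c + 1) := by
  rw [iterSum, binSum_succ_left F (N := (N - c).toNat) _ fun i hi => by
    rw [hg _ _ (by omega), smul_zero], sub_eq_add_neg, iterSum, iterSum, ← binSum_neg]
  congr 2
  · funext i
    rw [show a + 1 + b - i = a + (b + 1) - i by ring]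
  · funext i
    rw [pow_succ, mul_neg_one, neg_smul]
    push_cast
    rw [show a + 1 + b - (i + 1) = a + b - i by ring, show c + (i + 1) = c + 1 + i by ring]

theorem nestSum_succ {h : ℤ → ℤ → U} {N : ℤ} (hh : ∀ m n, N ≤ m → h m n = 0) (a b c : ℤ) :
    nestSum F h a (b + 1) c = nestSum F h a b (c + 1) + nestSum F h (a + 1) b c := by
  rw [nestSum, binSum_succ_left F (N := (N - a).toNat) _ fun i hi => hh _ _ (by omega),
    nestSum, nestSum]
  congr 2
  · funext i
    rw [show b + 1 + c - i = b + (c + 1) - i by ring]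
  · funext i
    push_cast
    rw [show b + 1 + c - (i + 1) = b + c - i by ring, show a + (i + 1) = a + 1 + i by ring]

end BinomialSums

/-! ### Divided powers -/

section DividedPowers

variable {U : Type} [AddCommGroup U] [Module F U] (D : U →ₗ[F] U)

/-- The divided power `Dⁿ / n!`, zero for negative `n`. -/
def divPow (n : ℤ) : U →ₗ[F] U :=
  if n < 0 then 0 else ((n.toNat.factorial : F)⁻¹) • D ^ n.toNat

theorem divPow_of_neg {n : ℤ} (hn : n < 0) : divPow F D n = 0 := by simp [divPow, hn]

theorem divPow_zero : divPow F D 0 = 1 := by simp [divPow]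

theorem divPow_natCast (n : ℕ) : divPow F D n = ((n.factorial : F)⁻¹) • D ^ n := by
  simp [divPow]

theorem apply_divPow (n : ℤ) (v : U) :
    D (divPow F D n v) = ((n : F) + 1) • divPow F D (n + 1) v := by
  rcases lt_trichotomy n (-1) with h | rfl | h
  · simp [divPow_of_neg F D (show n < 0 by omega), divPow_of_neg F D (show n + 1 < 0 by omega)]
  · simp [divPow_of_neg F D (show (-1 : ℤ) < 0 by omega)]
  · lift n to ℕ using by omega
    have h1 : (n : F) + 1 ≠ 0 := Nat.cast_add_one_ne_zero n
    rw [show (n : ℤ) + 1 = ((n + 1 : ℕ) : ℤ) by push_cast; ring, divPow_natCast, divPow_natCast,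
      LinearMap.smul_apply, LinearMap.smul_apply, map_smul, smul_smul, pow_succ',
      Nat.factorial_succ]
    push_cast
    congr 1
    field_simp

theorem divPow_apply (n : ℤ) (v : U) :
    divPow F D n (D v) = ((n : F) + 1) • divPow F D (n + 1) v := by
  rw [← apply_divPow]
  by_cases h : n < 0
  · simp [divPow_of_neg F D h]
  · simp only [divPow, h, if_false, LinearMap.smul_apply, map_smul]
    rw [← Module.End.mul_apply, ← Module.End.mul_apply, ← pow_succ, ← pow_succ']

/-- The sum `∑ₘ (-1)^(m+1) D^(m-n) (x m) / (m-n)!`. -/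
def skewSum (n : ℤ) (x : ℤ → U) : U :=
  ∑ᶠ m : ℤ, ((-1 : F) ^ (m + 1)) • divPow F D (m - n) (x m)

theorem skewSum_eq_sum {x : ℤ → U} {N : ℤ} (hx : ∀ m, N ≤ m → x m = 0) {c n : ℤ} (hc : c ≤ n) :
    skewSum F D n x =
      ∑ m ∈ Finset.Ico c N, ((-1 : F) ^ (m + 1)) • divPow F D (m - n) (x m) := by
  refine finsum_eq_sum_of_support_subset _ fun m hm => ?_
  by_contra hc'
  apply hm
  simp only [Finset.coe_Ico, Set.mem_Ico, not_and_or, not_le, not_lt] at hc'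
  rcases hc' with h | h
  · simp [divPow_of_neg F D (show m - n < 0 by omega)]
  · simp [hx m h]

theorem skewSum_add_nat (n : ℤ) (i : ℕ) (x : ℤ → U) :
    skewSum F D (n + i) x = (-1 : F) ^ i • skewSum F D n fun m => x (m + i) := by
  rw [skewSum, skewSum, smul_finsum, ← finsum_comp_equiv (Equiv.addRight (i : ℤ))]
  refine finsum_congr fun m => ?_
  rw [Equiv.coe_addRight, smul_smul, show m + i + 1 = (m + 1) + i by ring,
    zpow_add₀ (by simp : (-1 : F) ≠ 0), zpow_natCast, mul_comm,
    show m + i - (n + i) = m - n by ring]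

theorem skewSum_sum {ι : Type} (n : ℤ) (s : Finset ι) (r : ι → F) {x : ι → ℤ → U}
    (hx : ∀ i ∈ s, ∃ N : ℤ, ∀ m, N ≤ m → x i m = 0) :
    skewSum F D n (fun m => ∑ i ∈ s, r i • x i m) = ∑ i ∈ s, r i • skewSum F D n (x i) := by
  simp only [skewSum, map_sum, map_smul, Finset.smul_sum, smul_finsum]
  rw [finsum_sum_comm]
  · simp only [smul_comm (r _)]
  · intro i hi
    obtain ⟨N, hN⟩ := hx i hi
    refine (Finset.finite_toSet (Finset.Ico n N)).subset fun m hm => ?_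
    by_contra hc'
    apply hm
    simp only [Finset.coe_Ico, Set.mem_Ico, not_and_or, not_le, not_lt] at hc'
    rcases hc' with h | h
    · simp [divPow_of_neg F D (show m - n < 0 by omega)]
    · simp [hN m h]

end DividedPowers
/-! ### Vertex algebras from local weak commutativity and the `D`-bracket formula -/

section WeakCommutativity

variable {U : Type} [AddCommGroup U] [Module F U] (mul : ℤ → U →ₗ[F] U →ₗ[F] U)
  (one : U) (D : U →ₗ[F] U)

/-- Truncation: `u_n v = 0` for `n` sufficiently large. -/
def MulTruncated : Prop := ∀ u v : U, ∃ N : ℤ, ∀ n, N ≤ n → mul n u v = 0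

/-- The coefficients of `(x₁ - x₂)^k [Y(u, x₁), Y(v, x₂)] w` all vanish. -/
def WeakCommAt (k : ℕ) (u v w : U) : Prop :=
  ∀ b c : ℤ, ∑ j ∈ Finset.range (k + 1), ((-1 : F) ^ j * (k.choose j : F)) •
    (mul (b + k - j) u (mul (c + j) v w) - mul (c + j) v (mul (b + k - j) u w)) = 0

/-- The `D`-bracket formula `[D, Y(u, x)] = (d/dx) Y(u, x)`. -/
def DBracket : Prop := ∀ (n : ℤ) (u v : U),
  D (mul n u v) = mul n u (D v) - (n : F) • mul (n - 1) u v

variable {mul one D}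

theorem mul_one_eq_divPow (hc : ∀ v, mul (-1) v one = v) (hc0 : ∀ n, 0 ≤ n → ∀ v, mul n v one = 0)
    (hD : DBracket F mul D) (hD1 : D one = 0) (m : ℤ) (v : U) :
    mul m v one = divPow F D (-m - 1) v := by
  by_cases hm : 0 ≤ m
  · rw [hc0 m hm, divPow_of_neg F D (by omega), LinearMap.zero_apply]
  obtain ⟨n, rfl⟩ : ∃ n : ℕ, m = -1 - n := ⟨(-1 - m).toNat, by omega⟩
  clear hm
  induction n with
  | zero => simp [hc, divPow_zero]
  | succ n ih =>
    have h1 : (n : F) + 1 ≠ 0 := Nat.cast_add_one_ne_zero n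
    have h2 := hD (-1 - n) v one
    rw [ih, apply_divPow, hD1, map_zero, zero_sub, ← neg_smul] at h2
    refine (smul_right_injective U h1).eq_iff.1 ?_
    convert h2.symm using 2
    · push_cast; ring
    · push_cast; ring_nf
    · push_cast; ring
    · push_cast; ring_nf

theorem mul_divPow (hD : DBracket F mul D) (b : ℤ) (u : U) (q : ℤ) (v : U) :
    mul b u (divPow F D q v) =
      binSum F b fun i => divPow F D (q - i) (mul (b - i) u v) := by
  by_cases hq : q < 0
  · rw [divPow_of_neg F D hq, LinearMap.zero_apply, map_zero, binSum_eq_zero]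
    intro i
    rw [divPow_of_neg F D (by omega), LinearMap.zero_apply]
  lift q to ℕ using by omega
  clear hq
  induction q generalizing v with
  | zero =>
    rw [binSum_eq_sum F (N := 1)]
    · simp [gchoose_zero, divPow_zero]
    · intro i hi
      rw [divPow_of_neg F D (by omega), LinearMap.zero_apply]
  | succ q ih =>
    have h1 : (q : F) + 1 ≠ 0 := Nat.cast_add_one_ne_zero q
    have hvan : ∀ (p : ℤ) (i : ℕ) (w : U), p < i → divPow F D (p - i) w = 0 := fun p i w hi => by
      rw [divPow_of_neg F D (by omega), LinearMap.zero_apply]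
    refine (smul_right_injective U h1).eq_iff.1 ?_
    have h2 : ((q : F) + 1) • mul b u (divPow F D ((q + 1 : ℕ) : ℤ) v) =
        mul b u (divPow F D q (D v)) := by
      rw [divPow_apply, map_smul]
      push_cast
      rfl
    simp only [h2]
    rw [ih, binSum_eq_sum F _ (N := q + 2) fun i hi => hvan _ _ _ (by omega),
      binSum_eq_sum F _ (N := q + 2) fun i hi => hvan _ _ _ (by omega), Finset.smul_sum]
    set h : ℕ → U := fun i => divPow F D (((q + 1 : ℕ) : ℤ) - i) (mul (b - i) u v) with hh
    have hterm : ∀ i : ℕ, gchoose F b i • divPow F D ((q : ℤ) - i) (mul (b - i) u (D v)) =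
        ((q : F) + 1 - i) • gchoose F b i • h i +
          (((i + 1 : ℕ) : F) • gchoose F b (i + 1) • h (i + 1)) := by
      intro i
      have e : mul (b - i) u (D v) =
          D (mul (b - i) u v) + ((b : F) - i) • mul (b - (i + 1 : ℕ)) u v := by
        rw [hD]
        push_cast
        rw [show b - i - 1 = b - (i + 1) by ring]
        abel
      rw [e, map_add, map_smul, divPow_apply, smul_add, smul_smul, smul_smul, smul_smul, smul_smul]
      simp only [hh]
      push_cast
      rw [show (q : ℤ) + 1 - (i + 1) = q - i by ring, show (q : ℤ) - i + 1 = q + 1 - i by ring,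
        mul_comm ((i : F) + 1), gchoose_succ_mul]
      congr 2
      ring
    have hz : h (q + 2) = 0 := hvan _ _ _ (by push_cast; omega)
    have hshift := Finset.sum_range_succ' (fun i : ℕ => (i : F) • gchoose F b i • h i) (q + 2)
    rw [Finset.sum_range_succ, hz] at hshift
    simp only [smul_zero, add_zero, Nat.cast_zero, zero_smul] at hshift
    rw [Finset.sum_congr rfl fun i _ => hterm i, Finset.sum_add_distrib, ← hshift,
      ← Finset.sum_add_distrib]
    refine Finset.sum_congr rfl fun i _ => ?_
    rw [← add_smul, sub_add_cancel]

theorem iterSum_mul_divPow (hD : DBracket F mul D) (u v : U) (a b c : ℤ) :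
    iterSum F (fun m n => mul m u (divPow F D (-n) v)) a b c =
      nestSum F (fun m n => divPow F D (-m) (mul n u v)) c b a := by
  have hg : ∀ m n : ℤ, 1 ≤ n → mul m u (divPow F D (-n) v) = 0 := fun m n hn => by
    rw [divPow_of_neg F D (by omega), LinearMap.zero_apply, map_zero]
  have hh : ∀ m n : ℤ, 1 ≤ m → divPow F D (-m) (mul n u v) = 0 := fun m n hn => by
    rw [divPow_of_neg F D (by omega), LinearMap.zero_apply]
  obtain ⟨n, hn⟩ : ∃ n : ℕ, 1 ≤ c + n := ⟨(1 - c).toNat, by omega⟩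
  induction n generalizing a b c with
  | zero =>
    rw [iterSum_eq_zero F hg _ _ _ (by simpa using hn), nestSum_eq_zero F hh _ _ _ (by simpa using hn)]
  | succ n ih =>
    have step : ∀ a b : ℤ,
        iterSum F (fun m n => mul m u (divPow F D (-n) v)) (a + 1) b c -
          nestSum F (fun m n => divPow F D (-m) (mul n u v)) c b (a + 1) =
        iterSum F (fun m n => mul m u (divPow F D (-n) v)) a (b + 1) c -
          nestSum F (fun m n => divPow F D (-m) (mul n u v)) c (b + 1) a := by
      intro a b
      rw [iterSum_succ F hg, nestSum_succ F hh, ih a b (c + 1) (by push_cast at hn; omega)]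
      abel
    rw [← sub_eq_zero]
    induction a using Int.induction_on generalizing b with
    | zero =>
      rw [iterSum, binSum_zero_left, mul_divPow F hD, nestSum, sub_eq_zero]
      simp only [pow_zero, one_smul, Nat.cast_zero, zero_add, sub_zero, add_zero]
      congr 1
      funext i
      rw [neg_add', sub_eq_add_neg]
    | succ a iha => rw [step, iha]
    | pred a iha =>
      have := step (-a - 1) (b - 1)
      rw [sub_add_cancel, sub_add_cancel] at this
      rw [← this, iha]


variable (mul) in
/-- The coefficient of `x₀^(-a-1) x₁^(-b-1) x₂^(-c-1)` in the left-hand side of the Jacobi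
identity. -/
def commSum (u v w : U) (a b c : ℤ) : U :=
  iterSum F (fun m n => mul m u (mul n v w)) a b c -
    (-1 : F) ^ a • iterSum F (fun m n => mul m v (mul n u w)) a c b

theorem exists_mul_mul_eq_zero (ht : MulTruncated F mul) (u v w : U) :
    ∃ N : ℤ, ∀ m n, N ≤ n → mul m u (mul n v w) = 0 := by
  obtain ⟨N, hN⟩ := ht v w
  exact ⟨N, fun m n hn => by rw [hN n hn, map_zero]⟩

theorem commSum_succ (ht : MulTruncated F mul) (u v w : U) (a b c : ℤ) :
    commSum F mul u v w (a + 1) b c =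
      commSum F mul u v w a (b + 1) c - commSum F mul u v w a b (c + 1) := by
  obtain ⟨N, hN⟩ := exists_mul_mul_eq_zero F ht u v w
  obtain ⟨N', hN'⟩ := exists_mul_mul_eq_zero F ht v u w
  rw [commSum, commSum, commSum, iterSum_succ F hN, iterSum_succ F hN',
    zpow_add₀ (by simp : (-1 : F) ≠ 0), zpow_one, mul_neg_one, neg_smul, smul_sub]
  abel

theorem commSum_natCast (k : ℕ) (u v w : U) (b c : ℤ) :
    commSum F mul u v w k b c =
      ∑ j ∈ Finset.range (k + 1), ((-1 : F) ^ j * (k.choose j : F)) •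
        (mul (b + k - j) u (mul (c + j) v w) - mul (c + j) v (mul (b + k - j) u w)) := by
  rw [commSum, iterSum, iterSum, binSum_natCast, binSum_natCast]
  simp only [smul_sub, Finset.sum_sub_distrib]
  congr 1
  · refine Finset.sum_congr rfl fun j _ => ?_
    rw [smul_smul, mul_comm, add_comm (k : ℤ)]
  · rw [← Finset.sum_range_reflect, Finset.smul_sum]
    refine Finset.sum_congr rfl fun j hj => ?_
    have hj : j ≤ k := by simpa [Nat.lt_succ_iff] using hj
    rw [show k + 1 - 1 - j = k - j by omega, Nat.choose_symm hj, Nat.cast_sub hj, smul_smul,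
      smul_smul, zpow_natCast, show (k : ℤ) + c - (k - j) = c + j by ring,
      show b + ((k : ℤ) - j) = b + k - j by ring]
    congr 1
    obtain ⟨l, rfl⟩ := Nat.exists_eq_add_of_le hj
    rw [Nat.add_sub_cancel_left, pow_add]
    have : (-1 : F) ^ l * (-1 : F) ^ l = 1 := by rw [← mul_pow]; simp
    linear_combination (-1 : F) ^ j * ((j + l).choose j : F) * this

theorem commSum_eq_zero (ht : MulTruncated F mul) {k : ℕ} {u v w : U}
    (h : WeakCommAt F mul k u v w) {a : ℤ} (ha : k ≤ a) (b c : ℤ) :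
    commSum F mul u v w a b c = 0 := by
  induction a, ha using Int.leInduction generalizing b c with
  | base => rw [commSum_natCast, h b c]
  | succ a _ ih => rw [commSum_succ F ht, ih, ih, sub_zero]

theorem WeakCommAt.mono (ht : MulTruncated F mul) {k l : ℕ} {u v w : U}
    (h : WeakCommAt F mul k u v w) (hkl : k ≤ l) : WeakCommAt F mul l u v w := fun b c => by
  rw [← commSum_natCast, commSum_eq_zero F ht h (by exact_mod_cast hkl)]

theorem skew_symmetry (ht : MulTruncated F mul) (hc : ∀ v, mul (-1) v one = v)
    (hc0 : ∀ n, 0 ≤ n → ∀ v, mul n v one = 0) (hD : DBracket F mul D) (hD1 : D one = 0)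
    {u v : U} (hw : ∃ k, WeakCommAt F mul k u v one) (n : ℤ) :
    mul n v u = skewSum F D n fun m => mul m u v := by
  obtain ⟨k₀, hk₀⟩ := hw
  obtain ⟨N, hN⟩ := ht u v
  obtain ⟨k, hk, hkN⟩ : ∃ k : ℕ, k₀ ≤ k ∧ N ≤ k := ⟨max k₀ N.toNat, by omega, by omega⟩
  have hs : (-1 : F) ^ k * (-1 : F) ^ k = 1 := by rw [← mul_pow]; simp
  have h := commSum_eq_zero F ht hk₀ (a := k) (by omega) (-1) (n - k)
  have h1 : iterSum F (fun m p => mul m u (mul p v one)) k (-1) (n - k) =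
      iterSum F (fun m p => mul m u (divPow F D (-p) v)) k (-1) (n - k + 1) := by
    simp only [iterSum, mul_one_eq_divPow F hc hc0 hD hD1]
    congr 1
    funext i
    rw [show -(n - k + i) - 1 = -(n - k + 1 + i) by ring]
  have h2 : iterSum F (fun m p => mul m v (mul p u one)) k (n - k) (-1) = mul n v u := by
    rw [iterSum, binSum_natCast, Finset.sum_range_succ', Finset.sum_eq_zero]
    · simp [hc]
    · intro i _
      rw [hc0 _ (by push_cast; omega), map_zero, smul_zero, smul_zero]
  rw [commSum, h1, h2, iterSum_mul_divPow F hD, sub_eq_zero, zpow_natCast] at h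
  have h3 := congrArg (fun x => (-1 : F) ^ k • x) h
  simp only [smul_smul, hs, one_smul] at h3
  rw [← h3, skewSum_eq_sum F D (N := k) (fun m hm => hN m (by omega)) le_rfl, nestSum,
    binSum_eq_sum F _ (N := (k - n).toNat) fun i hi => by
      rw [divPow_of_neg F D (by omega), LinearMap.zero_apply], Finset.smul_sum]
  refine Finset.sum_nbij' (fun i => (k : ℤ) - 1 - i) (fun m => (k - 1 - m).toNat) ?_ ?_ ?_ ?_ ?_
  · intro i hi
    simp only [Finset.mem_range, Finset.mem_Ico] at hi ⊢
    omega
  · intro i hi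
    simp only [Finset.mem_range, Finset.mem_Ico] at hi ⊢
    omega
  · intro i hi
    simp only [Finset.mem_range] at hi
    omega
  · intro i hi
    simp only [Finset.mem_Ico] at hi
    omega
  · intro i hi
    rw [gchoose_neg_one, smul_smul, show -(n - k + 1 + i) = (k : ℤ) - 1 - i - n by ring,
      show -1 + (k : ℤ) - i = k - 1 - i by ring]
    congr 1
    rw [show (k : ℤ) - 1 - i + 1 = k - i by ring, zpow_sub₀ (by simp : (-1 : F) ≠ 0),
      zpow_natCast, zpow_natCast, div_eq_mul_inv, ← inv_pow, inv_neg_one]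

theorem iterSum_eq_nestSum (ht : MulTruncated F mul) (hD : DBracket F mul D)
    (hskew : ∀ (n : ℤ) (v u : U), mul n v u = skewSum F D n fun m => mul m u v)
    {k : ℕ} {u v w : U} (hw : WeakCommAt F mul k u w v) (a c : ℤ) :
    iterSum F (fun m n => mul m u (mul n v w)) a k c =
      nestSum F (fun m n => mul n (mul m u v) w) a k c := by
  obtain ⟨N, hN⟩ := ht w v
  have hsum (x : ℕ → ℤ → U) (hx : ∀ i, ∃ N : ℤ, ∀ m, N ≤ m → x i m = 0) :
      ∑ i ∈ Finset.range (k + 1), (k.choose i : F) • skewSum F D (c + i) (x i) =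
        skewSum F D c fun m => ∑ i ∈ Finset.range (k + 1),
          ((-1 : F) ^ i * (k.choose i : F)) • x i (m + i) := by
    rw [skewSum_sum]
    · refine Finset.sum_congr rfl fun i _ => ?_
      rw [skewSum_add_nat, smul_smul, mul_comm]
    · intro i _
      obtain ⟨N, hN⟩ := hx i
      exact ⟨N, fun m hm => hN _ (by omega)⟩
  have hL : iterSum F (fun m n => mul m u (mul n v w)) a k c =
      ∑ i ∈ Finset.range (k + 1), (k.choose i : F) •
        skewSum F D (c + i) fun m => mul (a + k - i) u (mul m w v) := by
    have e1 (i : ℕ) : (-1 : F) ^ i • mul (a + k - i) u (mul (c + i) v w) =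
        ∑ m ∈ Finset.Ico c N, (-1 : F) ^ (m + 1) • (-1 : F) ^ i •
          mul (a + k - i) u (divPow F D (-(c - m + i)) (mul m w v)) := by
      rw [hskew (c + i), skewSum_eq_sum F D hN (show c ≤ c + i by omega), map_sum, Finset.smul_sum]
      refine Finset.sum_congr rfl fun m _ => ?_
      rw [map_smul, smul_comm, show m - (c + i) = -(c - m + i) by ring]
    simp only [iterSum, e1]
    rw [binSum_sum]
    · have e2 (m : ℤ) : binSum F a (fun i => (-1 : F) ^ (m + 1) • (-1 : F) ^ i •
          mul (a + k - i) u (divPow F D (-(c - m + i)) (mul m w v))) =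
          ∑ i ∈ Finset.range (k + 1), (k.choose i : F) • (-1 : F) ^ (m + 1) •
            divPow F D (m - (c + i)) (mul (a + k - i) u (mul m w v)) := by
        have h := iterSum_mul_divPow F hD u (mul m w v) a k (c - m)
        rw [iterSum, nestSum, binSum_natCast] at h
        rw [binSum_smul, h, Finset.smul_sum]
        refine Finset.sum_congr rfl fun i _ => ?_
        rw [smul_comm, show -(c - m + i) = m - (c + i) by ring, add_comm (k : ℤ)]
      simp only [e2]
      rw [Finset.sum_comm]
      refine Finset.sum_congr rfl fun i _ => ?_
      rw [skewSum_eq_sum F D (N := N) (c := c) (fun m hm => by rw [hN m hm, map_zero]) (by omega),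
        Finset.smul_sum]
    · intro m _
      refine ⟨(m - c + 1).toNat, fun i hi => ?_⟩
      rw [divPow_of_neg F D (by omega), LinearMap.zero_apply, map_zero, smul_zero, smul_zero]
  have hR : nestSum F (fun m n => mul n (mul m u v) w) a k c =
      ∑ i ∈ Finset.range (k + 1), (k.choose i : F) •
        skewSum F D (c + i) fun m => mul m w (mul (a + k - i) u v) := by
    rw [nestSum, binSum_natCast, ← Finset.sum_range_reflect]
    refine Finset.sum_congr rfl fun i hi => ?_
    have hi : i ≤ k := by simpa [Nat.lt_succ_iff] using hi
    rw [← hskew, show k + 1 - 1 - i = k - i by omega, Nat.choose_symm hi, Nat.cast_sub hi,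
      show (k : ℤ) + c - (k - i) = c + i by ring, show a + ((k : ℤ) - i) = a + k - i by ring]
  rw [hL, hR, hsum _ fun i => ⟨N, fun m hm => by rw [hN m hm, map_zero]⟩,
    hsum _ fun i => ht w _]
  congr 1
  funext m
  rw [← sub_eq_zero, ← Finset.sum_sub_distrib]
  simpa only [smul_sub] using hw a m

theorem eq_zero_of_jacobi_recurrence {J : ℤ → ℤ → ℤ → U}
    (hJ : ∀ a b c, J (a + 1) b c = J a (b + 1) c - J a b (c + 1)) {K : ℤ}
    (ha : ∀ a b c, K ≤ a → J a b c = 0) (hb : ∀ a b c, K ≤ b → J a b c = 0) (a b c : ℤ) :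
    J a b c = 0 := by
  obtain ⟨n, hn⟩ : ∃ n : ℕ, 2 * K ≤ a + b + n := ⟨(2 * K - a - b).toNat, by omega⟩
  induction n generalizing a b c with
  | zero =>
    rcases le_or_gt K a with h | h
    · exact ha a b c h
    · exact hb a b c (by push_cast at hn; omega)
  | succ n ih =>
    have h := hJ a b (c - 1)
    rw [ih (a + 1) b (c - 1) (by push_cast at hn; omega),
      ih a (b + 1) (c - 1) (by push_cast at hn; omega), sub_add_cancel, zero_sub] at h
    exact neg_eq_zero.1 h.symm

theorem commSum_eq_nestSum (ht : MulTruncated F mul) (hc : ∀ v, mul (-1) v one = v)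
    (hc0 : ∀ n, 0 ≤ n → ∀ v, mul n v one = 0) (hD : DBracket F mul D) (hD1 : D one = 0)
    (hw : ∀ u v w, ∃ k, WeakCommAt F mul k u v w) (u v w : U) (a b c : ℤ) :
    commSum F mul u v w a b c = nestSum F (fun m n => mul n (mul m u v) w) a b c := by
  have hskew (n : ℤ) (v u : U) := skew_symmetry F ht hc hc0 hD hD1 (hw u v one) n
  obtain ⟨k, hk⟩ := hw u v w
  obtain ⟨l, hl⟩ := hw u w v
  obtain ⟨N, hN⟩ : ∃ N : ℤ, ∀ m n, N ≤ m → mul n (mul m u v) w = 0 := by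
    obtain ⟨N, hN⟩ := ht u v
    exact ⟨N, fun m n hm => by rw [hN m hm, map_zero, LinearMap.zero_apply]⟩
  obtain ⟨N', hN'⟩ := exists_mul_mul_eq_zero F ht v u w
  obtain ⟨K, h1, h2, h3, h4⟩ : ∃ K : ℤ, k ≤ K ∧ l ≤ K ∧ N ≤ K ∧ N' ≤ K :=
    ⟨max (max k l) (max N N'), by omega, by omega, by omega, by omega⟩
  refine sub_eq_zero.1 (eq_zero_of_jacobi_recurrence (K := K) (J := fun a b c =>
    commSum F mul u v w a b c - nestSum F (fun m n => mul n (mul m u v) w) a b c) ?_ ?_ ?_ a b c)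
  · intro a b c
    rw [commSum_succ F ht, nestSum_succ F hN]
    abel
  · intro a b c ha
    rw [commSum_eq_zero F ht hk (by omega), nestSum_eq_zero F hN _ _ _ (by omega), sub_zero]
  · intro a b c hb
    lift b to ℕ using by omega
    rw [commSum, iterSum_eq_zero F hN' _ _ _ (by omega), smul_zero, sub_zero,
      iterSum_eq_nestSum F ht hD hskew (hl.mono F ht (by omega)), sub_self]

end WeakCommutativity

/-! ### The products on the graded dual -/

section GradedDualProducts

open TensorProduct

variable (Δ : ℤ → V →ₗ[F] V ⊗[F] V) (c : V →ₗ[F] F) {gr : ℤ → Submodule F V}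

/-- The functional `u ⊗ v` on `V ⊗ M`. -/
abbrev pairT (u : Module.Dual F V) (v : Module.Dual F M) : Module.Dual F (V ⊗[F] M) :=
  dualDistrib F V M (u ⊗ₜ v)

/-- The product `u_n v` of functionals dual to `Δ n`. -/
def dualMul (n : ℤ) : Module.Dual F V →ₗ[F] Module.Dual F V →ₗ[F] Module.Dual F V :=
  (TensorProduct.mk F _ _).compr₂ ((Δ n).dualMap ∘ₗ dualDistrib F V V)

theorem dualMul_apply (n : ℤ) (u v : Module.Dual F V) (z : V) :
    dualMul F Δ n u v z = pairT F u v (Δ n z) := rfl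

theorem pairT_cRight (u : Module.Dual F V) (x : V ⊗[F] V) :
    pairT F u c x = u (cRight F c x) := by
  induction x with
  | zero => simp
  | add x y hx hy => simp only [map_add, hx, hy]
  | tmul a b => simp [cRight, mul_comm]

theorem pairT_cLeft (u : Module.Dual F V) (x : V ⊗[F] V) :
    pairT F c u x = u (cLeft F c x) := by
  induction x with
  | zero => simp
  | add x y hx hy => simp only [map_add, hx, hy]
  | tmul a b => simp [cLeft]

theorem pairT_map_right (u v : Module.Dual F V) (A : V →ₗ[F] V) (x : V ⊗[F] V) :
    pairT F u v (TensorProduct.map LinearMap.id A x) = pairT F u (v ∘ₗ A) x := by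
  induction x with
  | zero => simp
  | add x y hx hy => simp only [map_add, hx, hy]
  | tmul a b => simp

theorem pairT_map_left (u v : Module.Dual F V) (A : V →ₗ[F] V) (x : V ⊗[F] V) :
    pairT F u v (TensorProduct.map A LinearMap.id x) = pairT F (u ∘ₗ A) v x := by
  induction x with
  | zero => simp
  | add x y hx hy => simp only [map_add, hx, hy]
  | tmul a b => simp

theorem pairT_comp12 (u v w : Module.Dual F V) (m n : ℤ) (z : V) :
    pairT F u (pairT F v w) (comp12 F Δ m n z) = dualMul F Δ m u (dualMul F Δ n v w) z := by
  rw [dualMul_apply, comp12, LinearMap.comp_apply]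
  generalize Δ m z = x
  induction x with
  | zero => simp
  | add x y hx hy => simp only [map_add, hx, hy]
  | tmul a b => simp [dualMul_apply]

theorem pairT_Tfirst (u v w : Module.Dual F V) (x : V ⊗[F] (V ⊗[F] V)) :
    pairT F u (pairT F v w) (Tfirst F x) = pairT F v (pairT F u w) x := by
  induction x with
  | zero => simp
  | add x y hx hy => simp only [map_add, hx, hy]
  | tmul a y =>
    induction y with
    | zero => simp
    | add x y hx hy => simp only [tmul_add, map_add, hx, hy]
    | tmul b d => simp [Tfirst, mul_left_comm]

theorem pairT_compR (u v w : Module.Dual F V) (m n : ℤ) (z : V) :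
    pairT F u (pairT F v w) (compR F Δ Δ m n z) = dualMul F Δ n (dualMul F Δ m u v) w z := by
  have hassoc (y : V ⊗[F] V) (b : V) : pairT F u (pairT F v w)
      (TensorProduct.assoc F V V V (y ⊗ₜ b)) = pairT F u v y * w b := by
    induction y with
    | zero => simp
    | add x y hx hy => simp only [add_tmul, map_add, hx, hy, add_mul]
    | tmul a d => simp [mul_assoc]
  rw [dualMul_apply, compR, LinearMap.comp_apply, LinearMap.comp_apply]
  generalize Δ n z = x
  induction x with
  | zero => simp
  | add x y hx hy => simp only [map_add, hx, hy]
  | tmul a b =>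
    rw [TensorProduct.map_tmul, LinearEquiv.coe_coe, hassoc]
    simp [dualMul_apply]

theorem pairT_eq_zero_of_mem_grT2 {u v : Module.Dual F V} {s t : Finset ℤ}
    (hu : ∀ k ∉ s, ∀ x ∈ gr k, u x = 0) (hv : ∀ k ∉ t, ∀ x ∈ gr k, v x = 0) {m : ℤ}
    (hm : m ∉ Finset.image₂ (· + ·) s t) {x : V ⊗[F] V} (hx : x ∈ grT2 F gr m) :
    pairT F u v x = 0 := by
  suffices h : grT2 F gr m ≤ LinearMap.ker (pairT F u v) from h hx
  refine iSup_le fun p => LinearMap.range_le_ker_iff.2 (TensorProduct.ext' fun a b => ?_)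
  suffices h : u a * v b = 0 by simpa using h
  by_cases hp : p ∈ s
  · rw [hv (m - p) (fun ht => hm (Finset.mem_image₂.2 ⟨p, hp, m - p, ht, by ring⟩)) b b.2, mul_zero]
  · rw [hu p hp a a.2, zero_mul]

theorem gradedDual3_pairT {u v w : Module.Dual F V} (hu : u ∈ gradedDual F gr)
    (hv : v ∈ gradedDual F gr) (hw : w ∈ gradedDual F gr) :
    GradedDual3 F gr (pairT F u (pairT F v w)) := by
  obtain ⟨s, hs⟩ := hu
  obtain ⟨t, ht⟩ := hv
  obtain ⟨r, hr⟩ := hw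
  refine ⟨Finset.image₂ (· + ·) s (Finset.image₂ (· + ·) t r), fun m hm x hx => ?_⟩
  suffices h : grT3 F gr m ≤ LinearMap.ker (pairT F u (pairT F v w)) from h hx
  refine iSup_le fun p => LinearMap.range_le_ker_iff.2 ?_
  ext a b d
  suffices h : u a * (v b * w d) = 0 by simpa using h
  by_cases hp : p.1 ∈ s
  · by_cases hp' : p.2 ∈ t
    · rw [hr (m - p.1 - p.2) (fun hr' => hm (Finset.mem_image₂.2 ⟨p.1, hp, m - p.1,
        Finset.mem_image₂.2 ⟨p.2, hp', m - p.1 - p.2, hr', by ring⟩, by ring⟩)) d d.2, mul_zero,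
        mul_zero]
    · rw [ht p.2 hp' b b.2, zero_mul, mul_zero]
  · rw [hs p.1 hp a a.2, zero_mul]

theorem dualMul_mem {Δ : ℤ → V →ₗ[F] V ⊗[F] V} (hgr : IsGradedVC F Δ gr) (n : ℤ)
    {u v : Module.Dual F V} (hu : u ∈ gradedDual F gr) (hv : v ∈ gradedDual F gr) :
    dualMul F Δ n u v ∈ gradedDual F gr := by
  obtain ⟨s, hs⟩ := hu
  obtain ⟨t, ht⟩ := hv
  refine ⟨(Finset.image₂ (· + ·) s t).image (· - n - 1), fun r hr x hx => ?_⟩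
  refine pairT_eq_zero_of_mem_grT2 F hs ht (fun hm => hr ?_) (hgr.2.2 r n x hx)
  exact Finset.mem_image.2 ⟨_, hm, by ring⟩

/-- The product `u_n v` on the graded dual. -/
def gradedDualMul {Δ : ℤ → V →ₗ[F] V ⊗[F] V} (hgr : IsGradedVC F Δ gr) (n : ℤ) :
    gradedDual F gr →ₗ[F] gradedDual F gr →ₗ[F] gradedDual F gr :=
  LinearMap.mk₂ F (fun u v => ⟨dualMul F Δ n u v, dualMul_mem F hgr n u.2 v.2⟩)
    (fun _ _ _ => Subtype.ext (by simp)) (fun _ _ _ => Subtype.ext (by simp))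
    (fun _ _ _ => Subtype.ext (by simp)) (fun _ _ _ => Subtype.ext (by simp))

theorem coe_gradedDualMul {Δ : ℤ → V →ₗ[F] V ⊗[F] V} (hgr : IsGradedVC F Δ gr) (n : ℤ)
    (u v : gradedDual F gr) :
    (gradedDualMul F hgr n u v : Module.Dual F V) = dualMul F Δ n u v := rfl

theorem eq_zero_of_forall_mem_gr (hint : DirectSum.IsInternal gr) {u : Module.Dual F V}
    (hu : ∀ r, ∀ x ∈ gr r, u x = 0) : u = 0 := by
  rw [← LinearMap.ker_eq_top, eq_top_iff, ← hint.submodule_iSup_eq_top]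
  exact iSup_le fun r x hx => hu r x hx

theorem mulTruncated_gradedDualMul {Δ : ℤ → V →ₗ[F] V ⊗[F] V} (hgr : IsGradedVC F Δ gr) :
    MulTruncated F (U := gradedDual F gr) (gradedDualMul F hgr) := by
  rintro ⟨u, s, hs⟩ ⟨v, t, ht⟩
  obtain ⟨N, hN⟩ := hgr.2.1
  obtain ⟨B, hB⟩ := (Finset.image₂ (· + ·) s t).exists_le
  refine ⟨B - N, fun n hn => Subtype.ext (eq_zero_of_forall_mem_gr F hgr.1 fun r x hx => ?_)⟩
  by_cases hr : r < N
  · rw [hN r hr, Submodule.mem_bot] at hx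
    rw [hx, map_zero]
  · exact pairT_eq_zero_of_mem_grT2 F hs ht (fun hm => by have := hB _ hm; omega)
      (hgr.2.2 r n x hx)

theorem exists_proj (hint : DirectSum.IsInternal gr) (k : ℤ) :
    ∃ p : V →ₗ[F] V, (∀ x ∈ gr k, p x = x) ∧ ∀ j, j ≠ k → ∀ x ∈ gr j, p x = 0 := by
  classical
  let _ := hint.chooseDecomposition
  refine ⟨(gr k).subtype ∘ₗ DirectSum.component F ℤ (fun i => gr i) k ∘ₗ
    (DirectSum.decomposeLinearEquiv gr).toLinearMap, fun x hx => ?_, fun j hj x hx => ?_⟩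
  · exact DirectSum.decompose_of_mem_same gr hx
  · exact DirectSum.decompose_of_mem_ne gr hx hj

theorem counit_eq_zero {Δ : ℤ → V →ₗ[F] V ⊗[F] V} {c : V →ₗ[F] F} (hgr : IsGradedVC F Δ gr)
    (hleft : ∀ v, cLeft F c (Δ (-1) v) = v) (hright : ∀ v, cRight F c (Δ (-1) v) = v)
    {r : ℤ} (hr : r ≠ 0) {v : V} (hv : v ∈ gr r) : c v = 0 := by
  obtain ⟨p, hp, hp'⟩ := exists_proj F hgr.1 0
  obtain ⟨q, hq, hq'⟩ := exists_proj F hgr.1 r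
  have key : TensorProduct.map p LinearMap.id (Δ (-1) v) =
      TensorProduct.map LinearMap.id q (Δ (-1) v) := by
    have hmem : Δ (-1) v ∈ grT2 F gr r := by simpa using hgr.2.2 r (-1) v hv
    suffices h : grT2 F gr r ≤ LinearMap.eqLocus (TensorProduct.map p LinearMap.id)
      (TensorProduct.map LinearMap.id q) from h hmem
    refine iSup_le fun j => ?_
    rintro _ ⟨x, rfl⟩
    induction x with
    | zero => simp
    | add x y hx hy => rw [map_add]; exact add_mem hx hy
    | tmul a b =>
      rw [LinearMap.mem_eqLocus]
      by_cases hj : j = 0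
      · subst hj
        simp [hp a a.2, hq b (by simpa using b.2)]
      · simp [hp' j hj a a.2, hq' (r - j) (by omega) b b.2]
  calc c v = pairT F c c (TensorProduct.map LinearMap.id q (Δ (-1) v)) := by
        rw [pairT_map_right, pairT_cLeft, hleft, LinearMap.comp_apply, hq v hv]
    _ = 0 := by
        rw [← key, pairT_map_left, pairT_cRight, hright, LinearMap.comp_apply, hp' r hr v hv,
          map_zero]

theorem counit_mem_gradedDual {Δ : ℤ → V →ₗ[F] V ⊗[F] V} {c : V →ₗ[F] F}
    (hgr : IsGradedVC F Δ gr) (hleft : ∀ v, cLeft F c (Δ (-1) v) = v)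
    (hright : ∀ v, cRight F c (Δ (-1) v) = v) : c ∈ gradedDual F gr :=
  ⟨{0}, fun _ hr _ hv => counit_eq_zero F hgr hleft hright (by simpa using hr) hv⟩

theorem eq_of_forall_pairT_eq (hint : DirectSum.IsInternal gr) {x y : V ⊗[F] (V ⊗[F] V)}
    (h : ∀ u v w : gradedDual F gr, pairT F (u : Module.Dual F V) (pairT F v w) x =
      pairT F (u : Module.Dual F V) (pairT F v w) y) : x = y := by
  classical
  let B := hint.collectedBasis fun k => Module.Basis.ofVectorSpace F (gr k)
  have hB (i) : B.coord i ∈ gradedDual F gr :=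
    ⟨{i.1}, fun k hk v hv =>
      hint.collectedBasis_repr_of_mem_ne _ (by simpa using hk) hv⟩
  refine (B.tensorProduct (B.tensorProduct B)).ext_elem fun ⟨i, j, k⟩ => ?_
  have hrepr (x : V ⊗[F] (V ⊗[F] V)) : (B.tensorProduct (B.tensorProduct B)).repr x (i, j, k) =
      pairT F (B.coord i) (pairT F (B.coord j) (B.coord k)) x := by
    induction x with
    | zero => simp
    | add x y hx hy => simp only [map_add, Finsupp.add_apply, hx, hy]
    | tmul a y =>
      induction y with
      | zero => simp
      | add x y hx hy => simp only [tmul_add, map_add, Finsupp.add_apply, hx, hy]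
      | tmul b d =>
        simp only [Module.Basis.tensorProduct_repr_tmul_apply, dualDistrib_apply,
          Module.Basis.coord_apply, smul_eq_mul]
        ring
  rw [hrepr, hrepr]
  exact h ⟨_, hB i⟩ ⟨_, hB j⟩ ⟨_, hB k⟩


theorem gradedDualMul_vacuum_eq {Δ : ℤ → V →ₗ[F] V ⊗[F] V} {c : V →ₗ[F] F}
    (hgr : IsGradedVC F Δ gr) (hc : c ∈ gradedDual F gr) (n : ℤ) (v : gradedDual F gr) (z : V) :
    (gradedDualMul F hgr n v ⟨c, hc⟩ : Module.Dual F V) z =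
      (v : Module.Dual F V) (cRight F c (Δ n z)) := by
  rw [coe_gradedDualMul, dualMul_apply, pairT_cRight]

theorem dBracket_gradedDualMul {Δ : ℤ → V →ₗ[F] V ⊗[F] V} {c : V →ₗ[F] F}
    (hgr : IsGradedVC F Δ gr) (hc : c ∈ gradedDual F gr)
    (hDbr : ∀ (k : ℤ) (v : V),
      (-(k : F)) • Δ (k - 1) v =
        Δ k ((cRight F c ∘ₗ Δ (-2)) v) -
          TensorProduct.map LinearMap.id (cRight F c ∘ₗ Δ (-2)) (Δ k v)) :
    DBracket F (U := gradedDual F gr) (gradedDualMul F hgr)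
      ((gradedDualMul F hgr (-2)).flip ⟨c, hc⟩) := by
  intro n u v
  refine Subtype.ext (LinearMap.ext fun z => ?_)
  have h := congrArg (pairT F (u : Module.Dual F V) v) (hDbr n z)
  rw [map_sub, map_smul, pairT_map_right] at h
  have hv : (gradedDualMul F hgr (-2) v ⟨c, hc⟩ : Module.Dual F V) =
      (v : Module.Dual F V) ∘ₗ cRight F c ∘ₗ Δ (-2) :=
    LinearMap.ext fun z => gradedDualMul_vacuum_eq F hgr hc (-2) v z
  rw [LinearMap.flip_apply, gradedDualMul_vacuum_eq, LinearMap.flip_apply]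
  change pairT F (u : Module.Dual F V) v (Δ n ((cRight F c ∘ₗ Δ (-2)) z)) =
    pairT F (u : Module.Dual F V) (gradedDualMul F hgr (-2) v ⟨c, hc⟩ : Module.Dual F V) (Δ n z) -
      (n : F) • pairT F (u : Module.Dual F V) v (Δ (n - 1) z)
  rw [hv]
  rw [neg_smul] at h
  linear_combination -h

theorem finite_support_of_forall_le {W : Type*} [Zero W] {h : ℕ → W} (K : ℤ)
    (hK : ∀ i : ℕ, K ≤ i → h i = 0) : h.support.Finite := by
  refine (Finset.finite_toSet (Finset.range K.toNat)).subset fun i hi => ?_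
  by_contra hi'
  simp only [Finset.coe_range, Set.mem_Iio, not_lt] at hi'
  exact hi (hK i (by omega))

theorem coe_binSum_apply {h : ℕ → gradedDual F gr} {N : ℕ} (hN : ∀ i, N ≤ i → h i = 0) (a : ℤ)
    (z : V) : ((binSum F a h : gradedDual F gr) : Module.Dual F V) z =
      ∑ᶠ i : ℕ, gchoose F a i * (h i : Module.Dual F V) z := by
  rw [binSum_eq_sum F a hN, finsum_eq_sum_of_support_subset (s := Finset.range N)]
  · simp
  · intro i hi
    by_contra hc
    exact hi (by simp [hN i (by simpa using hc)])

end GradedDualProducts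

/-- If `(V, Y, c)` satisfies all the axioms of a graded vertex
coalgebra except possibly the Jacobi identity, and weak cocommutativity and the
`D*`-bracket formula `(d/dx)Y(x) = Y(x)∘D* - (Id ⊗ D*)∘Y(x)` hold, then the
Jacobi identity holds, so `(V, Y, c)` is a graded vertex coalgebra. -/
theorem jacobi_from_weak_cocom_and_Dstar_bracket
    (Δ : ℤ → V →ₗ[F] V ⊗[F] V) (c : V →ₗ[F] F) (gr : ℤ → Submodule F V)
    (hsans : IsVertexCoalgSansJacobi F Δ c) (hgr : IsGradedVC F Δ gr)
    (hwcom : ∀ (f : V ⊗[F] (V ⊗[F] V) →ₗ[F] F), GradedDual3 F gr f →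
      ∃ k : ℕ, 0 < k ∧ WeakCocom F Δ f k)
    (hDbr : ∀ (k : ℤ) (v : V),
      (-(k : F)) • Δ (k - 1) v =
        Δ k ((cRight F c ∘ₗ Δ (-2)) v) -
          TensorProduct.map LinearMap.id (cRight F c ∘ₗ Δ (-2)) (Δ k v)) :
    JacobiId F Δ Δ := by
  obtain ⟨hleft, hleft0, hright, hright0, htrunc⟩ := hsans
  have hc : c ∈ gradedDual F gr := counit_mem_gradedDual F hgr hleft hright
  have ht := mulTruncated_gradedDualMul F hgr
  have key := commSum_eq_nestSum F (U := gradedDual F gr) (mul := gradedDualMul F hgr)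
    (one := ⟨c, hc⟩) (D := (gradedDualMul F hgr (-2)).flip ⟨c, hc⟩) ht
    (fun v => Subtype.ext <| LinearMap.ext fun z => by
      rw [gradedDualMul_vacuum_eq, hright])
    (fun n hn v => Subtype.ext <| LinearMap.ext fun z => by
      rw [gradedDualMul_vacuum_eq, hright0 n hn, map_zero]; rfl)
    (dBracket_gradedDualMul F hgr hc hDbr)
    (Subtype.ext <| LinearMap.ext fun z => by
      rw [LinearMap.flip_apply, coe_gradedDualMul, dualMul_apply, pairT_cLeft,
        hleft0 (-2) (by decide), map_zero]
      rfl)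
    (fun u v w => by
      obtain ⟨k, -, hk⟩ := hwcom _ (gradedDual3_pairT F u.2 v.2 w.2)
      refine ⟨k, fun b d => Subtype.ext <| LinearMap.ext fun z => ?_⟩
      simpa [pairT_comp12, pairT_Tfirst, coe_gradedDualMul] using hk z b d)
  intro a b d z
  refine eq_of_forall_pairT_eq F hgr.1 fun u v w => ?_
  obtain ⟨N, hN⟩ := htrunc z
  have hcomp (m n : ℤ) (hm : m < N) : comp12 F Δ m n z = 0 := by
    rw [comp12, LinearMap.comp_apply, hN m hm, map_zero]
  have hcompR (m n : ℤ) (hn : n < N) : compR F Δ Δ m n z = 0 := by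
    rw [compR, LinearMap.comp_apply, LinearMap.comp_apply, hN n hn, map_zero, map_zero]
  rw [map_finsum _ (finite_support_of_forall_le (max (a + b - N + 1) (a + d - N + 1)) fun i hi => by
      rw [hcomp _ _ (by omega), hcomp _ _ (by omega), map_zero, smul_zero, sub_zero, smul_zero]),
    map_finsum _ (finite_support_of_forall_le (b + d - N + 1) fun i hi => by rw [hcompR _ _ (by omega), smul_zero])]
  have hJ := congrArg (fun f : gradedDual F gr => (f : Module.Dual F V) z) (key u v w a b d)
  obtain ⟨N₁, hN₁⟩ := exists_mul_mul_eq_zero F ht u v w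
  obtain ⟨N₂, hN₂⟩ := exists_mul_mul_eq_zero F ht v u w
  obtain ⟨N₃, hN₃⟩ := ht u v
  simp only [commSum, iterSum, nestSum] at hJ
  rw [Submodule.coe_sub, LinearMap.sub_apply, Submodule.coe_smul, LinearMap.smul_apply,
    coe_binSum_apply F (N := (N₁ - d).toNat) fun i hi => by
      rw [hN₁ _ _ (by omega), smul_zero],
    coe_binSum_apply F (N := (N₂ - b).toNat) fun i hi => by
      rw [hN₂ _ _ (by omega), smul_zero],
    coe_binSum_apply F (N := (N₃ - a).toNat) fun i hi => by
      rw [hN₃ _ (by omega), map_zero, LinearMap.zero_apply],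
    smul_finsum, ← finsum_sub_distrib] at hJ
  · refine (finsum_congr fun i => ?_).trans (hJ.trans (finsum_congr fun i => ?_))
    · simp only [map_smul, map_sub, pairT_comp12, pairT_Tfirst, Submodule.coe_smul,
        LinearMap.smul_apply, coe_gradedDualMul, smul_eq_mul]
      ring
    · simp only [map_smul, pairT_compR, coe_gradedDualMul, smul_eq_mul]
  · exact finite_support_of_forall_le (N₁ - d) fun i hi => by
      rw [hN₁ _ _ (by omega)]; simp
  · exact finite_support_of_forall_le (N₂ - b) fun i hi => by
      rw [hN₂ _ _ (by omega)]; simp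
end
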